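/- Let π denote the prime-counting function. For every integer n ≥ 137 one has Σ_{e≥2} (e−1) · π(n^{1/e}) < π(n), where π(n^{1/e}) means the number of primes p with p^e ≤ n, and the sum is finite since π(n^{1/e}) = 0 once n^{1/e} < 2. -/

import Mathlib

open Finset

/-- `piRoot n e` is `π(n^{1/e})`: the number of primes `p` with `p ^ e ≤ n`
(for `e ≥ 1` this is the prime-counting function evaluated at the real `e`-th
root of `n`).  Any such prime satisfies `p ≤ n`, so we may count inside `range (n+1)`. -/
def piRoot (n e : ℕ) : ℕ :=
  ((Finset.range (n + 1)).filter fun p => Nat.Prime p ∧ p ^ e ≤ n).card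

lemma piRoot_mono {m n : ℕ} (h : m ≤ n) (e : ℕ) : piRoot m e ≤ piRoot n e := by
  refine card_le_card fun p hp => ?_
  simp only [mem_filter, mem_range] at hp ⊢
  exact ⟨by lia, hp.2.1, hp.2.2.trans h⟩

lemma piRoot_eq_zero {n e : ℕ} (h : n < 2 ^ e) : piRoot n e = 0 := by
  refine card_eq_zero.2 (filter_eq_empty_iff.2 fun p _ hp => ?_)
  exact absurd (hp.2.trans_lt h) (Nat.pow_le_pow_left hp.1.two_le e).not_gt

lemma lt_of_pow_le {p d e n b : ℕ} (hp : p.Prime) (hde : d ≤ e) (h : p ^ e ≤ n)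
    (hb : n < b ^ d) : p < b :=
  lt_of_pow_lt_pow_left' d (((Nat.pow_le_pow_right hp.pos hde).trans h).trans_lt hb)

/-- The count defining `piRoot n e` may be restricted to `p < b` as soon as `n < b ^ d`, `d ≤ e`. -/
lemma piRoot_le_card_range {d e n b : ℕ} (hde : d ≤ e) (hb : n < b ^ d) :
    piRoot n e ≤ ((range b).filter fun p => p ^ e ≤ n ∧ Nat.Prime p).card := by
  refine card_le_card fun p hp => ?_
  simp only [mem_filter, mem_range] at hp ⊢
  exact ⟨lt_of_pow_le hp.2.1 hde hp.2.2 hb, hp.2.symm⟩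

lemma piRoot_le_of_lt_pow {d e n b : ℕ} (hde : d ≤ e) (hb : n < b ^ d) : piRoot n e ≤ b :=
  (piRoot_le_card_range hde hb).trans ((card_filter_le _ _).trans (card_range b).le)

/-- The terms with `e ≥ k` vanish when `n < 2 ^ k`. -/
lemma sum_sub_one_mul_piRoot_le {n N k : ℕ} (hn : n ≤ N) (hN : N < 2 ^ k) :
    ∑ e ∈ Icc 2 n, (e - 1) * piRoot n e ≤ ∑ e ∈ Ico 2 k, (e - 1) * piRoot N e := by
  calc ∑ e ∈ Icc 2 n, (e - 1) * piRoot n e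
      ≤ ∑ e ∈ Icc 2 n, (e - 1) * piRoot N e :=
        sum_le_sum fun e _ => Nat.mul_le_mul_left _ (piRoot_mono hn e)
    _ ≤ ∑ e ∈ Ico 2 k, (e - 1) * piRoot N e := by
        refine sum_le_sum_of_ne_zero fun e he h0 => mem_Ico.2 ⟨(mem_Icc.1 he).1, ?_⟩
        by_contra! hk
        exact h0 (by rw [piRoot_eq_zero (hN.trans_le (Nat.pow_le_pow_right two_pos hk)), mul_zero])

lemma piRoot_one (n : ℕ) : piRoot n 1 = Nat.primeCounting n := by
  rw [Nat.primeCounting, Nat.primeCounting', Nat.count_eq_card_filter_range]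
  refine congrArg card (Finset.ext fun p => ?_)
  simp only [mem_filter, mem_range, pow_one]
  constructor
  · exact fun h => ⟨h.1, h.2.1⟩
  · exact fun h => ⟨h.1, h.2, by lia⟩

lemma two_pow_le_mul_primeCounting_add_one (k : ℕ) (hk : k ≠ 0) :
    2 ^ k ≤ k * (Nat.primeCounting (2 ^ k) + 1) := by
  have hlog : (0 : ℝ) < Real.log 2 := Real.log_pos one_lt_two
  have h1 := (Chebyshev.psi_ge (2 ^ k)).trans (Chebyshev.psi_le_primeCounting_mul_log (2 ^ k))
  have h2 : Real.log ((2 ^ k : ℕ) + 1) < (k + 1) * Real.log 2 := by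
    have h : ((2 ^ k : ℕ) + 1 : ℝ) < 2 ^ (k + 1) := by
      have := Nat.one_lt_two_pow hk
      have : 2 ^ k + 1 < 2 ^ (k + 1) := by rw [pow_succ]; lia
      exact_mod_cast this
    calc Real.log ((2 ^ k : ℕ) + 1) < Real.log (2 ^ (k + 1)) :=
          Real.log_lt_log (by positivity) h
      _ = (k + 1) * Real.log 2 := by rw [Real.log_pow]; push_cast; ring
  have h3 : Real.log ((2 ^ k : ℕ) : ℝ) = k * Real.log 2 := by
    push_cast
    rw [Real.log_pow]
  rw [h3] at h1
  have h4 : (((2 ^ k : ℕ) : ℝ)) < Nat.primeCounting (2 ^ k) * k + (k + 1) := by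
    refine lt_of_mul_lt_mul_right ?_ hlog.le
    nlinarith
  have h5 : 2 ^ k < Nat.primeCounting (2 ^ k) * k + (k + 1) := by exact_mod_cast h4
  nlinarith

lemma two_pow_dominates (k : ℕ) (hk : 19 ≤ k) :
    k * (2 * 2 ^ ((k + 2) / 2) + 2 ^ ((k + 3) / 3) * k ^ 2 + 2) < 2 * 2 ^ k := by
  induction k using Nat.strong_induction_on with
  | _ k ih =>
    rcases lt_or_ge k 25 with h | h
    · interval_cases k <;> norm_num
    · obtain ⟨m, rfl⟩ : ∃ m, k = m + 6 := ⟨k - 6, by lia⟩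
      have hm := ih m (by lia) (by lia)
      rw [show (m + 6 + 2) / 2 = (m + 2) / 2 + 3 by lia,
        show (m + 6 + 3) / 3 = (m + 3) / 3 + 2 by lia, pow_add, pow_add, pow_add 2 m 6]
      generalize 2 ^ ((m + 2) / 2) = A at *
      generalize 2 ^ ((m + 3) / 3) = B at *
      have hle : m + 6 ≤ 2 * m := by lia
      calc (m + 6) * (2 * (A * 2 ^ 3) + B * 2 ^ 2 * (m + 6) ^ 2 + 2)
          ≤ (2 * m) * (2 * (A * 2 ^ 3) + B * 2 ^ 2 * (2 * m) ^ 2 + 2) := by gcongr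
        _ ≤ 64 * (m * (2 * A + B * m ^ 2 + 2)) := by
          ring_nf
          gcongr <;> norm_num
        _ < _ := by lia

lemma two_mul_sum_sub_one_le (k : ℕ) : 2 * ∑ e ∈ Ico 3 (k + 1), (e - 1) ≤ k ^ 2 := by
  induction k with
  | zero => simp
  | succ k ih =>
    rcases lt_or_ge k 2 with h | h
    · interval_cases k <;> simp
    · rw [sum_Ico_succ_top (by lia), Nat.add_sub_cancel]
      nlinarith

/-- A value `s` with `k * (s + 1) < 2 ^ k` lies below the prime count of any `n ≥ 2 ^ k`. -/
lemma lt_piRoot_of_dyadic {n k s : ℕ} (hk : k ≠ 0) (hn : 2 ^ k ≤ n)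
    (hs : k * (s + 1) < 2 ^ k) : s < piRoot n 1 := by
  have h := hs.trans_le (two_pow_le_mul_primeCounting_add_one k hk)
  rw [← piRoot_one] at h
  have := piRoot_mono hn 1
  have := lt_of_mul_lt_mul_left' h
  lia

/-- Bounds the term `e = 2` trivially and restricts the later ones to primes below `b`. -/
lemma sum_le_add_of_lt_sq_of_lt_cube {n N k a b : ℕ} (hn : n ≤ N) (hk : 2 < k) (hN : N < 2 ^ k)
    (ha : N < a ^ 2) (hb : N < b ^ 3) :
    ∑ e ∈ Icc 2 n, (e - 1) * piRoot n e ≤ a +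
      ∑ e ∈ Ico 3 k, (e - 1) * ((range b).filter fun p => p ^ e ≤ N ∧ Nat.Prime p).card := by
  refine (sum_sub_one_mul_piRoot_le hn hN).trans ?_
  rw [sum_eq_sum_Ico_succ_bot hk]
  refine add_le_add ?_ (sum_le_sum fun e he =>
    Nat.mul_le_mul_left _ (piRoot_le_card_range (mem_Ico.1 he).1 hb))
  rw [Nat.add_sub_cancel 1 1, one_mul]
  exact piRoot_le_of_lt_pow le_rfl ha

lemma lt_two_pow_ceil_div_pow {n k d : ℕ} (hd : d ≠ 0) (h : n < 2 ^ (k + 1)) :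
    n < (2 ^ ((k + d) / d)) ^ d := by
  rw [← pow_mul]
  refine h.trans_le (Nat.pow_le_pow_right two_pos ?_)
  rw [Nat.add_div_right k (Nat.pos_of_ne_zero hd), mul_comm]
  exact Nat.lt_mul_div_succ k (Nat.pos_of_ne_zero hd)

lemma sum_lt_of_large {n k : ℕ} (hk : 19 ≤ k) (h1 : 2 ^ k ≤ n) (h2 : n < 2 ^ (k + 1)) :
    ∑ e ∈ Icc 2 n, (e - 1) * piRoot n e < piRoot n 1 := by
  refine lt_piRoot_of_dyadic (by lia) h1 ?_
  have hd := two_pow_dominates k hk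
  have hq := two_mul_sum_sub_one_le k
  have hs := sum_le_add_of_lt_sq_of_lt_cube le_rfl (by lia) h2
    (lt_two_pow_ceil_div_pow two_ne_zero h2) (lt_two_pow_ceil_div_pow three_ne_zero h2)
  generalize 2 ^ ((k + 2) / 2) = A at *
  generalize 2 ^ ((k + 3) / 3) = B at *
  have h3 : ∑ e ∈ Ico 3 (k + 1),
      (e - 1) * ((range B).filter fun p => p ^ e ≤ n ∧ Nat.Prime p).card
      ≤ (∑ e ∈ Ico 3 (k + 1), (e - 1)) * B := by
    rw [sum_mul]
    exact sum_le_sum fun e _ =>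
      Nat.mul_le_mul_left _ ((card_filter_le _ _).trans (card_range B).le)
  have h5 : 2 * (∑ e ∈ Icc 2 n, (e - 1) * piRoot n e + 1) ≤ 2 * A + B * k ^ 2 + 2 := by
    have := Nat.mul_le_mul_right B hq
    nlinarith
  have := Nat.mul_le_mul_left k h5
  lia

lemma sum_le_of_lt_sq {n N k b : ℕ} (hn : n ≤ N) (hN : N < 2 ^ k) (hb : N < b ^ 2) :
    ∑ e ∈ Icc 2 n, (e - 1) * piRoot n e ≤
      ∑ e ∈ Ico 2 k, (e - 1) * ((range b).filter fun p => p ^ e ≤ N ∧ Nat.Prime p).card :=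
  (sum_sub_one_mul_piRoot_le hn hN).trans <| sum_le_sum fun _ he =>
    Nat.mul_le_mul_left _ (piRoot_le_card_range (mem_Ico.1 he).1 hb)

lemma sum_lt_of_medium {n k : ℕ} (hk : 11 ≤ k) (hk' : k < 19) (h1 : 2 ^ k ≤ n)
    (h2 : n < 2 ^ (k + 1)) :
    ∑ e ∈ Icc 2 n, (e - 1) * piRoot n e < piRoot n 1 := by
  have hN : 2 ^ (k + 1) - 1 < 2 ^ (k + 1) := Nat.sub_one_lt (by positivity)
  refine (sum_le_add_of_lt_sq_of_lt_cube (Nat.le_sub_one_of_lt h2) (by lia) hN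
    (lt_two_pow_ceil_div_pow two_ne_zero hN)
    (lt_two_pow_ceil_div_pow three_ne_zero hN)).trans_lt (lt_piRoot_of_dyadic (by lia) h1 ?_)
  clear h1 h2 hN
  interval_cases k <;> decide +kernel

lemma sum_lt_of_mem_Icc {n a N k b : ℕ} (ha : a ≤ n) (hn : n ≤ N) (hN : N < 2 ^ k)
    (hb : N < b ^ 2)
    (h : ∑ e ∈ Ico 2 k, (e - 1) * ((range b).filter fun p => p ^ e ≤ N ∧ Nat.Prime p).card
      < piRoot a 1) :
    ∑ e ∈ Icc 2 n, (e - 1) * piRoot n e < piRoot n 1 :=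
  ((sum_le_of_lt_sq hn hN hb).trans_lt h).trans_le (piRoot_mono ha 1)

lemma sum_lt_of_small {n : ℕ} (h1 : 137 ≤ n) (h2 : n < 2048) :
    ∑ e ∈ Icc 2 n, (e - 1) * piRoot n e < piRoot n 1 := by
  rcases lt_or_ge n 169 with h | h
  · exact sum_lt_of_mem_Icc h1 (Nat.le_of_lt_succ h) (k := 8) (b := 13)
      (by norm_num) (by norm_num) (by decide +kernel)
  rcases lt_or_ge n 243 with h₁ | h₁
  · exact sum_lt_of_mem_Icc h (Nat.le_of_lt_succ h₁) (k := 8) (b := 16)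
      (by norm_num) (by norm_num) (by decide +kernel)
  rcases lt_or_ge n 512 with h₂ | h₂
  · exact sum_lt_of_mem_Icc h₁ (Nat.le_of_lt_succ h₂) (k := 9) (b := 23)
      (by norm_num) (by norm_num) (by decide +kernel)
  rcases lt_or_ge n 1024 with h₃ | h₃
  · exact sum_lt_of_mem_Icc (a := 337) (by lia) (Nat.le_of_lt_succ h₃) (k := 10) (b := 32)
      (by norm_num) (by norm_num) (by decide +kernel)
  · exact (sum_le_of_lt_sq (Nat.le_of_lt_succ h2) (k := 11) (b := 46)
      (by norm_num) (by norm_num)).trans_lt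
        (lt_piRoot_of_dyadic (k := 10) (by norm_num) h₃ (by decide +kernel))

/-- For every `n ≥ 137`, `Σ_{e ≥ 2} (e−1) · π(n^{1/e}) < π(n)`.  The terms with `e > n`
vanish (since then `2^e > n`), so the sum over `2 ≤ e ≤ n` is the full sum; and
`π(n) = piRoot n 1`. -/
theorem sum_sub_one_mul_piRoot_lt_pi (n : ℕ) (hn : 137 ≤ n) :
    ∑ e ∈ Finset.Icc 2 n, (e - 1) * piRoot n e < piRoot n 1 := by
  rcases lt_or_ge n 2048 with h | h
  · exact sum_lt_of_small hn h
  have h1 : 2 ^ Nat.log 2 n ≤ n := Nat.pow_log_le_self 2 (by lia)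
  have h2 : n < 2 ^ (Nat.log 2 n + 1) := Nat.lt_pow_succ_log_self one_lt_two n
  have h3 : 11 ≤ Nat.log 2 n := Nat.le_log_of_pow_le one_lt_two (by lia)
  rcases lt_or_ge (Nat.log 2 n) 19 with hk | hk
  · exact sum_lt_of_medium h3 hk h1 h2
  · exact sum_lt_of_large hk h1 h2
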